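/- If S_t = I for all t ∈ [0,T] and S_T = I (so that 𝒮 ≡ 0 and ⦀𝒮⦀_T = 0), and if √T · ⦀φ⦀_T · ⦀Ā⦀_T < 1, then for every initial datum x̄₀ ∈ ℝⁿ the forward–backward system (NewRic) admits a unique solution (ξ, η) on [0,T]. -/

import Mathlib

open Matrix Set

noncomputable section

attribute [local instance] Matrix.normedAddCommGroup Matrix.normedSpace

/-- The operator (spectral) norm of a square real matrix. -/
def opN {k : ℕ} (M : Matrix (Fin k) (Fin k) ℝ) : ℝ :=
  ‖Matrix.toEuclideanCLM (𝕜 := ℝ) M‖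

/-- `⦀φ⦀_T = sup_{0≤t≤T} (‖φ(T,t)^* Q_T^{1/2}‖² + ∫_t^T ‖φ(s,t)^* Q_s^{1/2}‖² ds)^{1/2}`,
where `Qh` (resp. `QTh`) is the positive square root of `Q` (resp. `Q_T`). -/
def phiNorm {n : ℕ} (T : ℝ) (φ : ℝ → ℝ → Matrix (Fin n) (Fin n) ℝ)
    (Qh : ℝ → Matrix (Fin n) (Fin n) ℝ) (QTh : Matrix (Fin n) (Fin n) ℝ) : ℝ :=
  ⨆ t : Set.Icc (0:ℝ) T,
    Real.sqrt ((opN ((φ T t.1)ᵀ * QTh))^2 + ∫ s in t.1..T, (opN ((φ s t.1)ᵀ * Qh s))^2)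

/-- `⦀Ā⦀_T = sup_{0<t<T} ‖Ā_t Q_t^{−1/2}‖`. -/
def abarNorm {n : ℕ} (T : ℝ) (Abar Qh : ℝ → Matrix (Fin n) (Fin n) ℝ) : ℝ :=
  ⨆ t : Set.Ioo (0:ℝ) T, opN (Abar t.1 * (Qh t.1)⁻¹)

/-- `⦀𝒮⦀_T = sup_{0<t≤T} ‖Q_t^{−1/2} 𝒮_t Q_t^{−1/2}‖`, the terminal weights being
used at `t = T`. -/
def sNorm {n : ℕ} (T : ℝ) (S Qbar Qh : ℝ → Matrix (Fin n) (Fin n) ℝ)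
    (ST QbarT QTh : Matrix (Fin n) (Fin n) ℝ) : ℝ :=
  max (⨆ t : Set.Ioo (0:ℝ) T,
        opN ((Qh t.1)⁻¹ * (Qbar t.1 * (1 - S t.1)) * (Qh t.1)⁻¹))
      (opN (QTh⁻¹ * (QbarT * (1 - ST)) * QTh⁻¹))

/-- Solution predicate for the forward–backward system (NewRic). -/
def IsNewRicSol (n m : ℕ) (T : ℝ)
    (A Abar S Q Qbar : ℝ → Matrix (Fin n) (Fin n) ℝ)
    (B : ℝ → Matrix (Fin n) (Fin m) ℝ)
    (R : ℝ → Matrix (Fin m) (Fin m) ℝ)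
    (QT QbarT ST : Matrix (Fin n) (Fin n) ℝ)
    (x₀ : Fin n → ℝ) (ξ η : ℝ → Fin n → ℝ) : Prop :=
  (∀ t ∈ Set.Icc (0:ℝ) T, HasDerivWithinAt ξ
      ((A t + Abar t) *ᵥ ξ t - (B t * (R t)⁻¹ * (B t)ᵀ) *ᵥ η t)
      (Set.Icc (0:ℝ) T) t) ∧
  ξ 0 = x₀ ∧
  (∀ t ∈ Set.Icc (0:ℝ) T, HasDerivWithinAt η
      (-((Q t + Qbar t * (1 - S t)) *ᵥ ξ t + (A t)ᵀ *ᵥ η t))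
      (Set.Icc (0:ℝ) T) t) ∧
  η T = (QT + QbarT * (1 - ST)) *ᵥ ξ T

open MeasureTheory

section LinearODE

lemma ContinuousOn.exists_norm_le_Icc {E : Type*} [NormedAddCommGroup E]
    {f : ℝ → E} {a b : ℝ} (hf : ContinuousOn f (Icc a b)) :
    ∃ C : ℝ, 0 ≤ C ∧ ∀ t ∈ Icc a b, ‖f t‖ ≤ C := by
  obtain ⟨C, hC⟩ := isCompact_Icc.exists_bound_of_continuousOn hf
  exact ⟨max C 0, le_max_right _ _, fun t ht => (hC t ht).trans (le_max_left _ _)⟩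

variable {E : Type*} [NormedAddCommGroup E] [NormedSpace ℝ E]

lemma norm_le_exp_of_hasDerivWithinAt_Icc {f f' : ℝ → E} {K a b : ℝ}
    (hf : ∀ t ∈ Icc a b, HasDerivWithinAt f (f' t) (Icc a b) t)
    (bound : ∀ t ∈ Icc a b, ‖f' t‖ ≤ K * ‖f t‖) {t : ℝ} (ht : t ∈ Icc a b) :
    ‖f t‖ ≤ ‖f a‖ * Real.exp (K * (t - a)) := by
  have h := norm_le_gronwallBound_of_norm_deriv_right_le (f := f) (f' := f') (δ := ‖f a‖)
    (K := K) (ε := 0) (a := a) (b := b) (fun x hx => (hf x hx).continuousWithinAt)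
    (fun x hx => (hf x (Ico_subset_Icc_self hx)).mono_of_mem_nhdsWithin
      (Icc_mem_nhdsGE_of_mem hx)) le_rfl
    (fun x hx => by simpa using bound x (Ico_subset_Icc_self hx)) t ht
  rwa [gronwallBound_ε0] at h

/-- Coordinatewise truncation at level `N`. -/
def clampPi {ι : Type*} (N : ℝ) (x : ι → ℝ) : ι → ℝ := fun i => max (-N) (min N (x i))

variable {ι : Type*} [Fintype ι]

lemma clampPi_eq_self {N : ℝ} {x : ι → ℝ} (hx : ‖x‖ ≤ N) : clampPi N x = x := by
  funext i
  have h := abs_le.1 ((norm_le_pi_norm x i).trans hx)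
  simp [clampPi, h.1, h.2]

lemma norm_clampPi_le {N : ℝ} (hN : 0 ≤ N) (x : ι → ℝ) : ‖clampPi N x‖ ≤ N := by
  refine (pi_norm_le_iff_of_nonneg hN).2 fun i => abs_le.2 ⟨le_max_left _ _, ?_⟩
  exact max_le (by linarith) (min_le_left _ _)

lemma norm_clampPi_le_norm {N : ℝ} (hN : 0 ≤ N) (x : ι → ℝ) : ‖clampPi N x‖ ≤ ‖x‖ := by
  refine (pi_norm_le_iff_of_nonneg (norm_nonneg _)).2 fun i => abs_le.2 ?_
  have h := abs_le.1 (norm_le_pi_norm x i)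
  exact ⟨le_max_of_le_right (le_min (by linarith [norm_nonneg x]) h.1),
    max_le (by linarith [norm_nonneg x]) ((min_le_right _ _).trans h.2)⟩

lemma norm_clampPi_sub_le (N : ℝ) (x y : ι → ℝ) : ‖clampPi N x - clampPi N y‖ ≤ ‖x - y‖ := by
  refine (pi_norm_le_iff_of_nonneg (norm_nonneg _)).2 fun i => ?_
  refine le_trans ?_ (norm_le_pi_norm (x - y) i)
  simp only [clampPi, Pi.sub_apply, Real.norm_eq_abs]
  refine (abs_max_sub_max_le_max _ _ _ _).trans (max_le (by simp) ?_)
  exact (abs_min_sub_min_le_max _ _ _ _).trans (max_le (by simp) le_rfl)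

/-- Global existence for linear ODEs with continuous coefficients on a compact interval. -/
lemma exists_hasDerivWithinAt_linear {T : ℝ} (hT : 0 ≤ T)
    {L : ℝ → (ι → ℝ) →L[ℝ] (ι → ℝ)} (hL : ContinuousOn L (Icc 0 T)) (z : ι → ℝ) :
    ∃ x : ℝ → ι → ℝ, x 0 = z ∧
      ∀ t ∈ Icc (0 : ℝ) T, HasDerivWithinAt x (L t (x t)) (Icc 0 T) t := by
  obtain ⟨C, hC0, hC⟩ := hL.exists_norm_le_Icc
  set N : ℝ := ‖z‖ * Real.exp (C * T) with hN
  have hN0 : 0 ≤ N := by positivity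
  have hPL : IsPicardLindelof (fun t x => L t (clampPi N x)) (⟨0, left_mem_Icc.2 hT⟩ : Icc 0 T) z
      (⟨C * N * T, by positivity⟩) 0 ⟨C * N, by positivity⟩ ⟨C, hC0⟩ :=
    { lipschitzOnWith := fun t ht => by
        refine LipschitzOnWith.of_dist_le_mul fun x _ y _ => ?_
        rw [dist_eq_norm, dist_eq_norm, ← map_sub]
        exact (L t).le_of_opNorm_le_of_le (hC t ht) (norm_clampPi_sub_le N x y)
      continuousOn := fun x _ => hL.clm_apply continuousOn_const
      norm_le := fun t ht x _ =>
        (L t).le_of_opNorm_le_of_le (hC t ht) (norm_clampPi_le hN0 x)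
      mul_max_le := by
        simp only [sub_zero, max_eq_left hT, sub_self, NNReal.coe_zero]
        exact le_rfl }
  obtain ⟨x, hx0, hx⟩ := hPL.exists_eq_forall_mem_Icc_hasDerivWithinAt₀
  refine ⟨x, hx0, fun t ht => ?_⟩
  have hb := norm_le_exp_of_hasDerivWithinAt_Icc hx (K := C)
    (fun s hs => (L s).le_of_opNorm_le_of_le (hC s hs) (norm_clampPi_le_norm hN0 _)) ht
  have hxt : ‖x t‖ ≤ N := by
    refine hb.trans ?_
    simp only at hx0
    rw [hx0, hN]
    gcongr
    linarith [ht.2]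
  simpa only [clampPi_eq_self hxt] using hx t ht

/-- A linear ODE with continuous coefficients has a fundamental matrix. -/
lemma exists_fundamental_matrix [DecidableEq ι] {T : ℝ} (hT : 0 ≤ T) {H : ℝ → Matrix ι ι ℝ}
    (hH : ContinuousOn H (Icc 0 T)) :
    ∃ Ψ : ℝ → Matrix ι ι ℝ, Ψ 0 = 1 ∧ ∀ z : ι → ℝ, ∀ t ∈ Icc (0 : ℝ) T,
      HasDerivWithinAt (fun s => Ψ s *ᵥ z) (H t *ᵥ (Ψ t *ᵥ z)) (Icc 0 T) t := by
  let toL : Matrix ι ι ℝ →ₗ[ℝ] ((ι → ℝ) →L[ℝ] (ι → ℝ)) :=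
    LinearMap.toContinuousLinearMap.toLinearMap ∘ₗ (Matrix.toLin' (R := ℝ)).toLinearMap
  have hL : ContinuousOn (fun t => toL (H t)) (Icc 0 T) :=
    (LinearMap.continuous_of_finiteDimensional toL).comp_continuousOn hH
  choose x hx0 hx using fun i : ι => exists_hasDerivWithinAt_linear hT hL (Pi.single i 1)
  have key : ∀ t (z : ι → ℝ), (Matrix.of fun i j => x j t i) *ᵥ z = ∑ j, z j • x j t := by
    intro t z
    funext i
    simp [Matrix.mulVec, dotProduct, mul_comm]
  refine ⟨fun t => Matrix.of fun i j => x j t i, ?_, fun z t ht => ?_⟩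
  · ext i j
    simp [hx0, Matrix.one_apply, Pi.single_apply]
  · simp only [key, Matrix.mulVec_sum, Matrix.mulVec_smul]
    exact HasDerivWithinAt.fun_sum fun j _ => (hx j t ht).const_smul (z j)

end LinearODE

section EuclideanNorm

variable {n : ℕ}

/-- The Euclidean norm of a coordinate vector. -/
def euclNorm (v : Fin n → ℝ) : ℝ := ‖WithLp.toLp 2 v‖

lemma euclNorm_nonneg (v : Fin n → ℝ) : 0 ≤ euclNorm v := norm_nonneg _

lemma euclNorm_sq (v : Fin n → ℝ) : euclNorm v ^ 2 = v ⬝ᵥ v := by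
  rw [euclNorm, ← real_inner_self_eq_norm_sq, EuclideanSpace.inner_toLp_toLp, star_trivial]

lemma euclNorm_eq_zero {v : Fin n → ℝ} : euclNorm v = 0 ↔ v = 0 := by
  simp [euclNorm]

lemma dotProduct_le_euclNorm_mul (v w : Fin n → ℝ) : v ⬝ᵥ w ≤ euclNorm v * euclNorm w := by
  have h := real_inner_le_norm (WithLp.toLp 2 w) (WithLp.toLp 2 v)
  rwa [EuclideanSpace.inner_toLp_toLp, star_trivial, mul_comm] at h

lemma opN_nonneg (M : Matrix (Fin n) (Fin n) ℝ) : 0 ≤ opN M := norm_nonneg _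

lemma euclNorm_mulVec_le (M : Matrix (Fin n) (Fin n) ℝ) (v : Fin n → ℝ) :
    euclNorm (M *ᵥ v) ≤ opN M * euclNorm v :=
  (Matrix.toEuclideanCLM (𝕜 := ℝ) M).le_opNorm (WithLp.toLp 2 v)

lemma opN_mul_le (M N : Matrix (Fin n) (Fin n) ℝ) : opN (M * N) ≤ opN M * opN N := by
  rw [opN, map_mul]
  exact norm_mul_le _ _

lemma opN_transpose (M : Matrix (Fin n) (Fin n) ℝ) : opN Mᵀ = opN M := by
  rw [← Matrix.conjTranspose_eq_transpose_of_trivial, ← Matrix.star_eq_conjTranspose, opN, map_star]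
  exact norm_star (E := EuclideanSpace ℝ (Fin n) →L[ℝ] EuclideanSpace ℝ (Fin n)) _

lemma opN_sq (M : Matrix (Fin n) (Fin n) ℝ) : opN M ^ 2 = opN (M * Mᵀ) := by
  rw [← Matrix.conjTranspose_eq_transpose_of_trivial, ← Matrix.star_eq_conjTranspose, opN, opN,
    map_mul, map_star, sq]
  exact (CStarRing.norm_self_mul_star
    (E := EuclideanSpace ℝ (Fin n) →L[ℝ] EuclideanSpace ℝ (Fin n))).symm

/-- `Matrix.toEuclideanCLM` as a continuous linear map. -/
def euclCLM (n : ℕ) : Matrix (Fin n) (Fin n) ℝ →L[ℝ]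
    (EuclideanSpace ℝ (Fin n) →L[ℝ] EuclideanSpace ℝ (Fin n)) :=
  LinearMap.toContinuousLinearMap
    { toFun := fun M => Matrix.toEuclideanCLM (𝕜 := ℝ) M
      map_add' := map_add _
      map_smul' := map_smul _ }

lemma continuous_opN : Continuous (opN : Matrix (Fin n) (Fin n) ℝ → ℝ) :=
  continuous_norm.comp (euclCLM n).continuous

lemma HasDerivWithinAt.dotProduct {ι : Type*} [Fintype ι] {f g : ℝ → ι → ℝ} {f' g' : ι → ℝ}
    {s : Set ℝ} {t : ℝ} (hf : HasDerivWithinAt f f' s t) (hg : HasDerivWithinAt g g' s t) :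
    HasDerivWithinAt (fun τ => f τ ⬝ᵥ g τ) (f' ⬝ᵥ g t + f t ⬝ᵥ g') s t := by
  simp only [_root_.dotProduct, ← Finset.sum_add_distrib]
  exact HasDerivWithinAt.fun_sum fun i _ =>
    (hasDerivWithinAt_pi.1 hf i).mul (hasDerivWithinAt_pi.1 hg i)

lemma ContinuousOn.dotProduct {ι : Type*} [Fintype ι] {f g : ℝ → ι → ℝ} {s : Set ℝ}
    (hf : ContinuousOn f s) (hg : ContinuousOn g s) : ContinuousOn (fun τ => f τ ⬝ᵥ g τ) s := by
  rw [continuousOn_iff_continuous_domRestrict] at *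
  exact Continuous.dotProduct hf hg

lemma ContinuousOn.mulVec {ι κ : Type*} [Fintype ι] [Fintype κ] {M : ℝ → Matrix ι κ ℝ}
    {f : ℝ → κ → ℝ} {s : Set ℝ} (hM : ContinuousOn M s) (hf : ContinuousOn f s) :
    ContinuousOn (fun τ => M τ *ᵥ f τ) s := by
  rw [continuousOn_iff_continuous_domRestrict] at *
  exact Continuous.matrix_mulVec hM hf

lemma ContinuousOn.matrix_mul' {ι κ l : Type*} [Fintype κ] {M : ℝ → Matrix ι κ ℝ}
    {N : ℝ → Matrix κ l ℝ} {s : Set ℝ} (hM : ContinuousOn M s) (hN : ContinuousOn N s) :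
    ContinuousOn (fun τ => M τ * N τ) s := by
  rw [continuousOn_iff_continuous_domRestrict] at *
  exact Continuous.matrix_mul hM hN

lemma ContinuousOn.transpose {ι κ : Type*} {M : ℝ → Matrix ι κ ℝ} {s : Set ℝ}
    (hM : ContinuousOn M s) : ContinuousOn (fun τ => (M τ)ᵀ) s := by
  rw [continuousOn_iff_continuous_domRestrict] at *
  exact Continuous.matrix_transpose hM

lemma ContinuousOn.matrix_inv {ι : Type*} [Fintype ι] [DecidableEq ι] {M : ℝ → Matrix ι ι ℝ}
    {s : Set ℝ} (hM : ContinuousOn M s) (h : ∀ t ∈ s, (M t).det ≠ 0) :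
    ContinuousOn (fun τ => (M τ)⁻¹) s := by
  simp only [Matrix.inv_def, Ring.inverse_eq_inv']
  rw [continuousOn_iff_continuous_domRestrict] at *
  exact ((Continuous.matrix_det hM).inv₀ fun t => h t t.2).smul (Continuous.matrix_adjugate hM)

/-- Cauchy–Schwarz for continuous functions on an interval, with an extra scalar component. -/
lemma sq_add_integral_mul_le {f g : ℝ → ℝ} {a b c d : ℝ} (hab : a ≤ b)
    (hf : ContinuousOn f (Icc a b)) (hg : ContinuousOn g (Icc a b)) :
    (c * d + ∫ s in a..b, f s * g s) ^ 2 ≤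
      (c ^ 2 + ∫ s in a..b, f s ^ 2) * (d ^ 2 + ∫ s in a..b, g s ^ 2) := by
  rw [← uIcc_of_le hab] at hf hg
  have hff : IntervalIntegrable (fun s => f s ^ 2) volume a b := (hf.pow 2).intervalIntegrable
  have hgg : IntervalIntegrable (fun s => g s ^ 2) volume a b := (hg.pow 2).intervalIntegrable
  have hfg : IntervalIntegrable (fun s => f s * g s) volume a b := (hf.mul hg).intervalIntegrable
  have key : ∀ x : ℝ, 0 ≤ (d ^ 2 + ∫ s in a..b, g s ^ 2) * (x * x) +
      (2 * (c * d + ∫ s in a..b, f s * g s)) * x + (c ^ 2 + ∫ s in a..b, f s ^ 2) := by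
    intro x
    have h : 0 ≤ ∫ s in a..b, (f s + x * g s) ^ 2 :=
      intervalIntegral.integral_nonneg hab fun s _ => sq_nonneg _
    have h2 : ∫ s in a..b, (f s + x * g s) ^ 2 = (∫ s in a..b, f s ^ 2) +
        2 * x * (∫ s in a..b, f s * g s) + x ^ 2 * ∫ s in a..b, g s ^ 2 := by
      rw [← intervalIntegral.integral_const_mul, ← intervalIntegral.integral_const_mul,
        ← intervalIntegral.integral_add hff (hfg.const_mul _),
        ← intervalIntegral.integral_add (hff.add (hfg.const_mul _)) (hgg.const_mul _)]
      congr 1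
      funext s
      ring
    nlinarith [sq_nonneg (c + x * d)]
  have := discrim_le_zero key
  rw [discrim] at this
  nlinarith

lemma integral_eq_sub_of_hasDerivWithinAt_Icc {f f' : ℝ → ℝ} {a b : ℝ} (hab : a ≤ b)
    (hf : ∀ t ∈ Icc a b, HasDerivWithinAt f (f' t) (Icc a b) t)
    (hf' : ContinuousOn f' (Icc a b)) : ∫ t in a..b, f' t = f b - f a :=
  intervalIntegral.integral_eq_sub_of_hasDerivAt_of_le hab
    (fun t ht => (hf t ht).continuousWithinAt)
    (fun t ht => (hf t (Ioo_subset_Icc_self ht)).hasDerivAt (Icc_mem_nhds ht.1 ht.2))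
    (by rw [← uIcc_of_le hab] at hf'; exact hf'.intervalIntegrable)

end EuclideanNorm

section Homogeneous

variable {n : ℕ}

lemma mulVec_dotProduct_eq (M : Matrix (Fin n) (Fin n) ℝ) (v w : Fin n → ℝ) :
    (M *ᵥ v) ⬝ᵥ w = v ⬝ᵥ (Mᵀ *ᵥ w) := by
  rw [dotProduct_comm, dotProduct_mulVec, ← mulVec_transpose, dotProduct_comm]

lemma Matrix.PosSemidef.transpose_eq_self {P : Matrix (Fin n) (Fin n) ℝ} (hP : P.PosSemidef) :
    Pᵀ = P := by
  rw [← Matrix.conjTranspose_eq_transpose_of_trivial]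
  exact hP.isHermitian

lemma mulVec_dotProduct_of_sqrt {P M : Matrix (Fin n) (Fin n) ℝ}
    (hP : P.PosSemidef ∧ P * P = M) (v w : Fin n → ℝ) :
    (M *ᵥ v) ⬝ᵥ w = (P *ᵥ v) ⬝ᵥ (P *ᵥ w) := by
  rw [← hP.2, ← mulVec_mulVec, mulVec_dotProduct_eq, hP.1.transpose_eq_self]

lemma mulVec_dotProduct_mulVec_le {P M : Matrix (Fin n) (Fin n) ℝ}
    (hP : P.PosSemidef ∧ P * P = M) (X : Matrix (Fin n) (Fin n) ℝ) (v w : Fin n → ℝ) :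
    (M *ᵥ v) ⬝ᵥ (X *ᵥ w) ≤ euclNorm w * (opN (Xᵀ * P) * euclNorm (P *ᵥ v)) := by
  have h : opN (Xᵀ * P) = opN (P * X) := by
    rw [← opN_transpose (P * X), transpose_mul, hP.1.transpose_eq_self]
  rw [mulVec_dotProduct_of_sqrt hP, h, mulVec_mulVec]
  calc _ ≤ euclNorm (P *ᵥ v) * euclNorm ((P * X) *ᵥ w) := dotProduct_le_euclNorm_mul _ _
    _ ≤ euclNorm (P *ᵥ v) * (opN (P * X) * euclNorm w) := by
        gcongr
        · exact euclNorm_nonneg _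
        · exact euclNorm_mulVec_le _ _
    _ = _ := by ring

lemma opN_transpose_mul_eq_sqrt {P M : Matrix (Fin n) (Fin n) ℝ}
    (hP : P.PosSemidef ∧ P * P = M) (X : Matrix (Fin n) (Fin n) ℝ) :
    opN (Xᵀ * P) = √(opN (Xᵀ * M * X)) := by
  rw [← Real.sqrt_sq (opN_nonneg (Xᵀ * P)), opN_sq, transpose_mul, transpose_transpose,
    hP.1.transpose_eq_self, ← hP.2]
  simp only [mul_assoc]

lemma euclNorm_mulVec_eq_sqrt {P M : Matrix (Fin n) (Fin n) ℝ}
    (hP : P.PosSemidef ∧ P * P = M) (v : Fin n → ℝ) :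
    euclNorm (P *ᵥ v) = √((M *ᵥ v) ⬝ᵥ v) := by
  rw [← Real.sqrt_sq (euclNorm_nonneg (P *ᵥ v)), euclNorm_sq, mulVec_dotProduct_of_sqrt hP]

variable {T : ℝ} {A Q Qh : ℝ → Matrix (Fin n) (Fin n) ℝ} {QT QTh : Matrix (Fin n) (Fin n) ℝ}
  {φ : ℝ → ℝ → Matrix (Fin n) (Fin n) ℝ} {ξ η : ℝ → Fin n → ℝ}

lemma continuousOn_euclNorm_sqrt_mulVec (hQc : ContinuousOn Q (Icc 0 T))
    (hQh : ∀ t ∈ Icc (0 : ℝ) T, (Qh t).PosSemidef ∧ Qh t * Qh t = Q t)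
    (hξ : ContinuousOn ξ (Icc 0 T)) :
    ContinuousOn (fun s => euclNorm (Qh s *ᵥ ξ s)) (Icc 0 T) :=
  ((hQc.mulVec hξ).dotProduct hξ).sqrt.congr fun s hs => euclNorm_mulVec_eq_sqrt (hQh s hs) _

/-- The squared energy norm of a state trajectory. -/
def stateEnergy (T : ℝ) (Qh : ℝ → Matrix (Fin n) (Fin n) ℝ) (QTh : Matrix (Fin n) (Fin n) ℝ)
    (ξ : ℝ → Fin n → ℝ) : ℝ :=
  euclNorm (QTh *ᵥ ξ T) ^ 2 + ∫ s in (0 : ℝ)..T, euclNorm (Qh s *ᵥ ξ s) ^ 2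

lemma euclNorm_adjoint_le (hT : 0 ≤ T) (hQc : ContinuousOn Q (Icc 0 T))
    (hQh : ∀ t ∈ Icc (0 : ℝ) T, (Qh t).PosSemidef ∧ Qh t * Qh t = Q t)
    (hQTh : QTh.PosSemidef ∧ QTh * QTh = QT)
    (hφ : ∀ s ∈ Icc (0 : ℝ) T, φ s s = 1 ∧ ∀ t ∈ Icc (0 : ℝ) T,
      HasDerivWithinAt (fun τ => φ τ s) (A t * φ t s) (Icc (0 : ℝ) T) t)
    {Φ : ℝ} (hΦ0 : 0 ≤ Φ)
    (hΦ : ∀ t ∈ Icc (0 : ℝ) T,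
      opN ((φ T t)ᵀ * QTh) ^ 2 + ∫ s in t..T, opN ((φ s t)ᵀ * Qh s) ^ 2 ≤ Φ ^ 2)
    (hξ : ContinuousOn ξ (Icc 0 T))
    (hη : ∀ t ∈ Icc (0 : ℝ) T,
      HasDerivWithinAt η (-(Q t *ᵥ ξ t + (A t)ᵀ *ᵥ η t)) (Icc 0 T) t)
    (hηT : η T = QT *ᵥ ξ T) {t : ℝ} (ht : t ∈ Icc 0 T) :
    euclNorm (η t) ≤ Φ * √(stateEnergy T Qh QTh ξ) := by
  have hsub : Icc t T ⊆ Icc 0 T := Icc_subset_Icc_left ht.1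
  have hφc : ContinuousOn (fun s => φ s t) (Icc 0 T) :=
    fun s hs => ((hφ t ht).2 s hs).continuousWithinAt
  set v := η t with hv
  have hw : ∀ s ∈ Icc (0 : ℝ) T,
      HasDerivWithinAt (fun s => φ s t *ᵥ v) (A s *ᵥ (φ s t *ᵥ v)) (Icc 0 T) s := by
    intro s hs
    let ev : Matrix (Fin n) (Fin n) ℝ →L[ℝ] (Fin n → ℝ) :=
      LinearMap.toContinuousLinearMap ((Matrix.mulVecBilin ℝ ℝ).flip v)
    have h := ev.hasFDerivAt.comp_hasDerivWithinAt s ((hφ t ht).2 s hs)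
    rw [mulVec_mulVec]
    exact h
  have hwc : ContinuousOn (fun s => φ s t *ᵥ v) (Icc 0 T) := fun s hs =>
    (hw s hs).continuousWithinAt
  have hFTC := integral_eq_sub_of_hasDerivWithinAt_Icc (a := t) (b := T)
    (f := fun s => η s ⬝ᵥ (φ s t *ᵥ v)) (f' := fun s => -((Q s *ᵥ ξ s) ⬝ᵥ (φ s t *ᵥ v))) ht.2
    (fun s hs => by
      have h := ((hη s (hsub hs)).dotProduct (hw s (hsub hs))).mono hsub
      refine h.congr_deriv ?_
      rw [neg_dotProduct, add_dotProduct, mulVec_dotProduct_eq (A s)ᵀ, transpose_transpose]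
      ring)
    (((hQc.mulVec hξ).dotProduct hwc).neg.mono hsub)
  rw [intervalIntegral.integral_neg, (hφ t ht).1, one_mulVec, ← hv, ← euclNorm_sq, hηT] at hFTC
  set f : ℝ → ℝ := fun s => opN ((φ s t)ᵀ * Qh s) with hf
  set g : ℝ → ℝ := fun s => euclNorm (Qh s *ᵥ ξ s) with hg
  have hfc : ContinuousOn f (Icc 0 T) :=
    (continuous_opN.comp_continuousOn
      ((hφc.transpose.matrix_mul' hQc).matrix_mul' hφc)).sqrt.congr
      fun s hs => opN_transpose_mul_eq_sqrt (hQh s hs) _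
  have hgc : ContinuousOn g (Icc 0 T) := continuousOn_euclNorm_sqrt_mulVec hQc hQh hξ
  set c := opN ((φ T t)ᵀ * QTh) with hc
  set d := euclNorm (QTh *ᵥ ξ T) with hd
  have hII : ∀ {k : ℝ → ℝ} {a : ℝ}, a ∈ Icc 0 T → ContinuousOn k (Icc 0 T) →
      IntervalIntegrable k volume a T := fun {k a} ha hk => by
    have := hk.mono (Icc_subset_Icc_left ha.1)
    rw [← uIcc_of_le ha.2] at this
    exact this.intervalIntegrable
  have h1 : ∫ s in t..T, (Q s *ᵥ ξ s) ⬝ᵥ (φ s t *ᵥ v) ≤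
      ∫ s in t..T, euclNorm v * (f s * g s) :=
    intervalIntegral.integral_mono_on ht.2 (hII ht ((hQc.mulVec hξ).dotProduct hwc))
      (hII ht (continuousOn_const.mul (hfc.mul hgc)))
      fun s hs => mulVec_dotProduct_mulVec_le (hQh s (hsub hs)) _ _ _
  rw [intervalIntegral.integral_const_mul] at h1
  have h2 := mulVec_dotProduct_mulVec_le hQTh (φ T t) (ξ T) v
  have hE : d ^ 2 + ∫ s in t..T, g s ^ 2 ≤ stateEnergy T Qh QTh ξ := by
    have hsplit := intervalIntegral.integral_add_adjacent_intervals
      (a := 0) (b := t) (c := T) (f := fun s => g s ^ 2) (μ := volume)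
      ((hII (left_mem_Icc.2 hT) (hgc.pow 2)).mono_set (by
        rw [uIcc_of_le ht.1, uIcc_of_le hT]; exact Icc_subset_Icc_right ht.2))
      (hII ht (hgc.pow 2))
    have hnn : 0 ≤ ∫ s in (0 : ℝ)..t, g s ^ 2 :=
      intervalIntegral.integral_nonneg ht.1 fun s _ => sq_nonneg _
    rw [stateEnergy]
    linarith
  have hE0 : 0 ≤ d ^ 2 + ∫ s in t..T, g s ^ 2 :=
    add_nonneg (sq_nonneg _) (intervalIntegral.integral_nonneg ht.2 fun s _ => sq_nonneg _)
  have hCS : c * d + ∫ s in t..T, f s * g s ≤ Φ * √(stateEnergy T Qh QTh ξ) := by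
    refine le_of_abs_le (abs_le_of_sq_le_sq ?_ (by positivity))
    rw [mul_pow, Real.sq_sqrt (hE0.trans hE)]
    exact (sq_add_integral_mul_le ht.2 (hfc.mono hsub) (hgc.mono hsub)).trans
      (mul_le_mul (hΦ t ht) hE hE0 (sq_nonneg _))
  have hmain : euclNorm v * euclNorm v ≤ euclNorm v * (c * d + ∫ s in t..T, f s * g s) := by
    nlinarith
  rcases (euclNorm_nonneg v).eq_or_lt with h0 | h0
  · rw [← h0]; positivity
  · exact (le_of_mul_le_mul_left hmain h0).trans hCS

lemma newRic_homogeneous_eq_zero (hT : 0 < T) {Abar G : ℝ → Matrix (Fin n) (Fin n) ℝ}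
    (hAbarc : ContinuousOn Abar (Icc 0 T))
    (hQc : ContinuousOn Q (Icc 0 T)) (hGc : ContinuousOn G (Icc 0 T))
    (hQ : ∀ t ∈ Icc (0 : ℝ) T, (Q t).PosDef)
    (hG : ∀ t ∈ Icc (0 : ℝ) T, ∀ v, 0 ≤ (G t *ᵥ v) ⬝ᵥ v)
    (hQh : ∀ t ∈ Icc (0 : ℝ) T, (Qh t).PosSemidef ∧ Qh t * Qh t = Q t)
    (hQTh : QTh.PosSemidef ∧ QTh * QTh = QT)
    (hφ : ∀ s ∈ Icc (0 : ℝ) T, φ s s = 1 ∧ ∀ t ∈ Icc (0 : ℝ) T,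
      HasDerivWithinAt (fun τ => φ τ s) (A t * φ t s) (Icc (0 : ℝ) T) t)
    {Φ α : ℝ} (hΦ0 : 0 ≤ Φ)
    (hΦ : ∀ t ∈ Icc (0 : ℝ) T,
      opN ((φ T t)ᵀ * QTh) ^ 2 + ∫ s in t..T, opN ((φ s t)ᵀ * Qh s) ^ 2 ≤ Φ ^ 2)
    (hα0 : 0 ≤ α) (hα : ∀ t ∈ Ioo (0 : ℝ) T, opN (Abar t * (Qh t)⁻¹) ≤ α)
    (hcond : √T * Φ * α < 1)
    (hξ : ∀ t ∈ Icc (0 : ℝ) T,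
      HasDerivWithinAt ξ ((A t + Abar t) *ᵥ ξ t - G t *ᵥ η t) (Icc 0 T) t)
    (hξ0 : ξ 0 = 0)
    (hη : ∀ t ∈ Icc (0 : ℝ) T,
      HasDerivWithinAt η (-(Q t *ᵥ ξ t + (A t)ᵀ *ᵥ η t)) (Icc 0 T) t)
    (hηT : η T = QT *ᵥ ξ T) :
    ∀ t ∈ Icc (0 : ℝ) T, ξ t = 0 ∧ η t = 0 := by
  have hξc : ContinuousOn ξ (Icc 0 T) := fun t ht => (hξ t ht).continuousWithinAt
  have hηc : ContinuousOn η (Icc 0 T) := fun t ht => (hη t ht).continuousWithinAt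
  have hη_le : ∀ t ∈ Icc (0 : ℝ) T, euclNorm (η t) ≤ Φ * √(stateEnergy T Qh QTh ξ) :=
    fun t ht => euclNorm_adjoint_le hT.le hQc hQh hQTh hφ hΦ0 hΦ hξc hη hηT ht
  set E := stateEnergy T Qh QTh ξ with hEdef
  set g : ℝ → ℝ := fun s => euclNorm (Qh s *ᵥ ξ s) with hg
  have hgc : ContinuousOn g (Icc 0 T) := continuousOn_euclNorm_sqrt_mulVec hQc hQh hξc
  have hII : ∀ {k : ℝ → ℝ}, ContinuousOn k (Icc 0 T) → IntervalIntegrable k volume 0 T :=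
    fun {k} hk => by rw [← uIcc_of_le hT.le] at hk; exact hk.intervalIntegrable
  have hg2 : 0 ≤ ∫ s in (0 : ℝ)..T, g s ^ 2 :=
    intervalIntegral.integral_nonneg hT.le fun s _ => sq_nonneg _
  have hE0 : 0 ≤ E := add_nonneg (sq_nonneg _) hg2
  have hgE : ∫ s in (0 : ℝ)..T, g s ≤ √T * √E := by
    refine le_of_abs_le (abs_le_of_sq_le_sq ?_ (by positivity))
    have h := sq_add_integral_mul_le (f := fun _ => 1) (g := g) (c := 0) (d := 0) hT.le
      continuousOn_const hgc
    simp only [mul_zero, one_mul, zero_add, one_pow, intervalIntegral.integral_const, smul_eq_mul,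
      mul_one, sub_zero, ne_eq, OfNat.ofNat_ne_zero, not_false_eq_true, zero_pow] at h
    rw [mul_pow, Real.sq_sqrt hE0, Real.sq_sqrt hT.le]
    refine h.trans (mul_le_mul_of_nonneg_left ?_ hT.le)
    rw [hEdef, stateEnergy]
    linarith [sq_nonneg (euclNorm (QTh *ᵥ ξ T))]
  have hcξη := (hAbarc.mulVec hξc).dotProduct hηc
  have hcG := (hGc.mulVec hηc).dotProduct hηc
  have henergy := integral_eq_sub_of_hasDerivWithinAt_Icc (a := 0) (b := T)
    (f := fun s => ξ s ⬝ᵥ η s)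
    (f' := fun s => (Abar s *ᵥ ξ s) ⬝ᵥ η s - (G s *ᵥ η s) ⬝ᵥ η s - g s ^ 2) hT.le
    (fun s hs => by
      refine ((hξ s hs).dotProduct (hη s hs)).congr_deriv ?_
      have hq : g s ^ 2 = ξ s ⬝ᵥ (Q s *ᵥ ξ s) := by
        rw [hg, euclNorm_sq, ← mulVec_dotProduct_of_sqrt (hQh s hs), dotProduct_comm]
      rw [hq, add_mulVec, sub_dotProduct, add_dotProduct, dotProduct_neg, dotProduct_add,
        mulVec_dotProduct_eq (A s)]
      ring)
    ((hcξη.sub hcG).sub (hgc.pow 2))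
  rw [intervalIntegral.integral_sub
      (f := fun s => (Abar s *ᵥ ξ s) ⬝ᵥ η s - (G s *ᵥ η s) ⬝ᵥ η s) (g := fun s => g s ^ 2)
      (hII (hcξη.sub hcG)) (hII (hgc.pow 2)),
    intervalIntegral.integral_sub (hII hcξη) (hII hcG), hξ0, zero_dotProduct, hηT, dotProduct_comm,
    mulVec_dotProduct_of_sqrt hQTh, ← euclNorm_sq] at henergy
  have hGint : 0 ≤ ∫ s in (0 : ℝ)..T, (G s *ᵥ η s) ⬝ᵥ η s :=
    intervalIntegral.integral_nonneg hT.le fun s hs => hG s hs _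
  have hcross : ∫ s in (0 : ℝ)..T, (Abar s *ᵥ ξ s) ⬝ᵥ η s ≤
      ∫ s in (0 : ℝ)..T, (α * (Φ * √E)) * g s := by
    refine intervalIntegral.integral_mono_on_of_le_Ioo hT.le (hII hcξη)
      (hII (continuousOn_const.mul hgc)) fun s hs => ?_
    have hs' := Ioo_subset_Icc_self hs
    have hdet : IsUnit (Qh s).det := by
      refine isUnit_iff_ne_zero.2 fun h0 => (hQ s hs').det_pos.ne' ?_
      rw [← (hQh s hs').2, det_mul, h0, zero_mul]
    have hfac : Abar s *ᵥ ξ s = (Abar s * (Qh s)⁻¹) *ᵥ (Qh s *ᵥ ξ s) := by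
      rw [mulVec_mulVec, mul_assoc, nonsing_inv_mul _ hdet, mul_one]
    have h1 : euclNorm (Abar s *ᵥ ξ s) ≤ α * g s := by
      rw [hfac]
      exact (euclNorm_mulVec_le _ _).trans
        (mul_le_mul_of_nonneg_right (hα s hs) (euclNorm_nonneg _))
    calc _ ≤ euclNorm (Abar s *ᵥ ξ s) * euclNorm (η s) := dotProduct_le_euclNorm_mul _ _
      _ ≤ (α * g s) * (Φ * √E) := mul_le_mul h1 (hη_le s hs') (euclNorm_nonneg _)
          (mul_nonneg hα0 (euclNorm_nonneg _))
      _ = _ := by ring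
  rw [intervalIntegral.integral_const_mul] at hcross
  have hEle : E ≤ (√T * Φ * α) * E := by
    have h1 : E ≤ α * (Φ * √E) * ∫ s in (0 : ℝ)..T, g s := by
      have hEeq : E = euclNorm (QTh *ᵥ ξ T) ^ 2 + ∫ s in (0 : ℝ)..T, g s ^ 2 := rfl
      linarith
    refine h1.trans ((mul_le_mul_of_nonneg_left hgE (by positivity)).trans_eq ?_)
    linear_combination (√T * Φ * α) * Real.mul_self_sqrt hE0
  have hE : E = 0 := by nlinarith
  intro t ht
  constructor
  · have hgt : g t = 0 := by
      by_contra hne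
      have hpos : 0 < ∫ s in (0 : ℝ)..T, g s ^ 2 :=
        intervalIntegral.integral_pos hT (hgc.pow 2) (fun s _ => sq_nonneg _)
          ⟨t, ht, by positivity⟩
      rw [hEdef, stateEnergy] at hE
      linarith [sq_nonneg (euclNorm (QTh *ᵥ ξ T))]
    have h0 : Qh t *ᵥ ξ t = 0 := euclNorm_eq_zero.1 hgt
    by_contra hne
    have hpos := (hQ t ht).dotProduct_mulVec_pos hne
    rw [star_trivial, dotProduct_comm, mulVec_dotProduct_of_sqrt (hQh t ht), h0,
      zero_dotProduct] at hpos
    exact hpos.false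
  · have h := hη_le t ht
    rw [hE, Real.sqrt_zero, mul_zero] at h
    exact euclNorm_eq_zero.1 (le_antisymm h (euclNorm_nonneg _))

end Homogeneous

lemma bddAbove_phiNorm {n : ℕ} {T : ℝ} {A Q Qh : ℝ → Matrix (Fin n) (Fin n) ℝ}
    {QTh : Matrix (Fin n) (Fin n) ℝ} {φ : ℝ → ℝ → Matrix (Fin n) (Fin n) ℝ}
    (hAc : ContinuousOn A (Icc 0 T)) (hQc : ContinuousOn Q (Icc 0 T))
    (hQh : ∀ t ∈ Icc (0 : ℝ) T, (Qh t).PosSemidef ∧ Qh t * Qh t = Q t)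
    (hφ : ∀ s ∈ Icc (0 : ℝ) T, φ s s = 1 ∧ ∀ t ∈ Icc (0 : ℝ) T,
      HasDerivWithinAt (fun τ => φ τ s) (A t * φ t s) (Icc (0 : ℝ) T) t) :
    BddAbove (Set.range fun t : Icc (0 : ℝ) T =>
      √(opN ((φ T t.1)ᵀ * QTh) ^ 2 + ∫ s in t.1..T, opN ((φ s t.1)ᵀ * Qh s) ^ 2)) := by
  obtain ⟨C, hC0, hC⟩ := (continuous_opN.comp_continuousOn hAc).exists_norm_le_Icc
  obtain ⟨D, hD0, hD⟩ := (continuous_opN.comp_continuousOn hQc).exists_norm_le_Icc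
  set K := opN (1 : Matrix (Fin n) (Fin n) ℝ) * Real.exp (C * T) with hK
  have hK0 : 0 ≤ K := mul_nonneg (opN_nonneg _) (Real.exp_pos _).le
  have hφK : ∀ t ∈ Icc (0 : ℝ) T, ∀ s ∈ Icc t T, opN (φ s t)ᵀ ≤ K := by
    intro t ht s hs
    have hsub : Icc t T ⊆ Icc 0 T := Icc_subset_Icc_left ht.1
    have h := norm_le_exp_of_hasDerivWithinAt_Icc (K := C)
      (f := fun τ => euclCLM n (φ τ t)) (f' := fun τ => euclCLM n (A τ * φ τ t))
      (fun τ hτ => (euclCLM n).hasFDerivAt.comp_hasDerivWithinAt τ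
        (((hφ t ht).2 τ (hsub hτ)).mono hsub))
      (fun τ hτ => (opN_mul_le _ _).trans (mul_le_mul_of_nonneg_right
        ((le_abs_self _).trans (hC τ (hsub hτ))) (opN_nonneg _))) hs
    rw [(hφ t ht).1] at h
    rw [opN_transpose]
    refine h.trans (mul_le_mul_of_nonneg_left (Real.exp_le_exp.2 ?_) (opN_nonneg _))
    exact mul_le_mul_of_nonneg_left (by linarith [hs.2, ht.1]) hC0
  refine ⟨√((K * opN QTh) ^ 2 + K ^ 2 * D * T), ?_⟩
  rintro _ ⟨⟨t, ht⟩, rfl⟩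
  refine Real.sqrt_le_sqrt (add_le_add (pow_le_pow_left₀ (opN_nonneg _)
    ((opN_mul_le _ _).trans (mul_le_mul_of_nonneg_right
      (hφK t ht T (right_mem_Icc.2 ht.2)) (opN_nonneg _))) 2) ?_)
  have h := intervalIntegral.norm_integral_le_of_norm_le_const (a := t) (b := T) (C := K ^ 2 * D)
    (f := fun s => opN ((φ s t)ᵀ * Qh s) ^ 2) fun s hs => by
      rw [uIoc_of_le ht.2] at hs
      have hs0 : s ∈ Icc (0 : ℝ) T := ⟨ht.1.trans hs.1.le, hs.2⟩
      have hQs : opN (Qh s) ^ 2 ≤ D := by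
        rw [opN_sq, (hQh s hs0).1.transpose_eq_self, (hQh s hs0).2]
        exact (le_abs_self _).trans (hD s hs0)
      rw [Real.norm_of_nonneg (sq_nonneg _)]
      calc _ ≤ (K * opN (Qh s)) ^ 2 := pow_le_pow_left₀ (opN_nonneg _) ((opN_mul_le _ _).trans
              (mul_le_mul_of_nonneg_right (hφK t ht s ⟨hs.1.le, hs.2⟩) (opN_nonneg _))) 2
        _ ≤ _ := by rw [mul_pow]; exact mul_le_mul_of_nonneg_left hQs (sq_nonneg _)
  refine (le_abs_self _).trans (h.trans ?_)
  rw [abs_of_nonneg (sub_nonneg.2 ht.2)]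
  exact mul_le_mul_of_nonneg_left (by linarith [ht.1]) (by positivity)

/-- Corollary 3.5: if `S ≡ I` (so that `𝒮 ≡ 0`) and
`√T ⦀φ⦀_T ⦀Ā⦀_T < 1`, then (NewRic) has a unique solution for every initial datum. -/
theorem exists_unique_newRic_of_S_eq_I
    (n m : ℕ) (T : ℝ) (hT : 0 < T)
    (A Abar S Q Qbar : ℝ → Matrix (Fin n) (Fin n) ℝ)
    (B : ℝ → Matrix (Fin n) (Fin m) ℝ)
    (R : ℝ → Matrix (Fin m) (Fin m) ℝ)
    (QT QbarT ST : Matrix (Fin n) (Fin n) ℝ)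
    (hAc : ContinuousOn A (Set.Icc 0 T)) (hAbarc : ContinuousOn Abar (Set.Icc 0 T))
    (hBc : ContinuousOn B (Set.Icc 0 T)) (hSc : ContinuousOn S (Set.Icc 0 T))
    (hQc : ContinuousOn Q (Set.Icc 0 T)) (hQbarc : ContinuousOn Qbar (Set.Icc 0 T))
    (hRc : ContinuousOn R (Set.Icc 0 T))
    (hQ : ∀ t ∈ Set.Icc (0:ℝ) T, (Q t).PosDef)
    (hQbar : ∀ t ∈ Set.Icc (0:ℝ) T, (Qbar t).PosSemidef)
    (hR : ∀ t ∈ Set.Icc (0:ℝ) T, (R t).PosDef)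
    (δ : ℝ) (hδ : 0 < δ)
    (hRδ : ∀ t ∈ Set.Icc (0:ℝ) T,
      (R t - δ • (1 : Matrix (Fin m) (Fin m) ℝ)).PosSemidef)
    (hQT : QT.PosDef) (hQbarT : QbarT.PosSemidef)
    -- `Qh t` is the positive semidefinite square root of `Q t`, `QTh` that of `Q_T`
    (Qh : ℝ → Matrix (Fin n) (Fin n) ℝ) (QTh : Matrix (Fin n) (Fin n) ℝ)
    (hQh : ∀ t ∈ Set.Icc (0:ℝ) T, (Qh t).PosSemidef ∧ Qh t * Qh t = Q t)
    (hQTh : QTh.PosSemidef ∧ QTh * QTh = QT)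
    -- `φ` is the fundamental solution associated with `A`
    (φ : ℝ → ℝ → Matrix (Fin n) (Fin n) ℝ)
    (hφ : ∀ s ∈ Set.Icc (0:ℝ) T, φ s s = 1 ∧
      ∀ t ∈ Set.Icc (0:ℝ) T,
        HasDerivWithinAt (fun τ => φ τ s) (A t * φ t s) (Set.Icc (0:ℝ) T) t)
    -- `⦀Ā⦀_T < ∞` and `⦀𝒮⦀_T < ∞`
    (hAbarFin : BddAbove (Set.range fun t : Set.Ioo (0:ℝ) T =>
        opN (Abar t.1 * (Qh t.1)⁻¹)))
    (hS1 : ∀ t ∈ Set.Icc (0:ℝ) T, S t = 1) (hST1 : ST = 1)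
    (hcond : Real.sqrt T * phiNorm T φ Qh QTh * abarNorm T Abar Qh < 1)
    (x₀ : Fin n → ℝ) :
    (∃ ξ η : ℝ → Fin n → ℝ,
        IsNewRicSol n m T A Abar S Q Qbar B R QT QbarT ST x₀ ξ η) ∧
    (∀ ξ₁ η₁ ξ₂ η₂ : ℝ → Fin n → ℝ,
        IsNewRicSol n m T A Abar S Q Qbar B R QT QbarT ST x₀ ξ₁ η₁ →
        IsNewRicSol n m T A Abar S Q Qbar B R QT QbarT ST x₀ ξ₂ η₂ →
        ∀ t ∈ Set.Icc (0:ℝ) T, ξ₁ t = ξ₂ t ∧ η₁ t = η₂ t) := by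
  have hΦ0 : 0 ≤ phiNorm T φ Qh QTh := Real.iSup_nonneg fun _ => Real.sqrt_nonneg _
  have hα0 : 0 ≤ abarNorm T Abar Qh := Real.iSup_nonneg fun _ => opN_nonneg _
  have hΦ : ∀ t ∈ Icc (0 : ℝ) T, opN ((φ T t)ᵀ * QTh) ^ 2 +
      ∫ s in t..T, opN ((φ s t)ᵀ * Qh s) ^ 2 ≤ phiNorm T φ Qh QTh ^ 2 := fun t ht =>
    (Real.sqrt_le_left hΦ0).1
      (le_ciSup (bddAbove_phiNorm hAc hQc hQh (QTh := QTh) hφ) (⟨t, ht⟩ : Icc (0 : ℝ) T))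
  have hα : ∀ t ∈ Ioo (0 : ℝ) T, opN (Abar t * (Qh t)⁻¹) ≤ abarNorm T Abar Qh := fun t ht =>
    le_ciSup hAbarFin (⟨t, ht⟩ : Ioo (0 : ℝ) T)
  set G : ℝ → Matrix (Fin n) (Fin n) ℝ := fun t => B t * (R t)⁻¹ * (B t)ᵀ
  have hGc : ContinuousOn G (Icc 0 T) :=
    (hBc.matrix_mul' (hRc.matrix_inv fun t ht => (hR t ht).det_pos.ne')).matrix_mul' hBc.transpose
  have hG : ∀ t ∈ Icc (0 : ℝ) T, ∀ v, 0 ≤ (G t *ᵥ v) ⬝ᵥ v := fun t ht v => by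
    have h := ((hR t ht).inv.posSemidef.mul_mul_conjTranspose_same (B t)).dotProduct_mulVec_nonneg v
    rwa [star_trivial, conjTranspose_eq_transpose_of_trivial, dotProduct_comm] at h
  have hST : QT + QbarT * (1 - ST) = QT := by simp [hST1]
  have hSt : ∀ t ∈ Icc (0 : ℝ) T, Q t + Qbar t * (1 - S t) = Q t := fun t ht => by
    simp [hS1 t ht]
  have hzero : ∀ ξ η : ℝ → Fin n → ℝ,
      IsNewRicSol n m T A Abar S Q Qbar B R QT QbarT ST 0 ξ η →
      ∀ t ∈ Icc (0 : ℝ) T, ξ t = 0 ∧ η t = 0 := fun ξ η h =>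
    newRic_homogeneous_eq_zero hT hAbarc hQc hGc hQ hG hQh hQTh hφ hΦ0 hΦ hα0 hα hcond
      h.1 h.2.1 (fun t ht => by rw [← hSt t ht]; exact h.2.2.1 t ht) (by rw [h.2.2.2, hST])
  refine ⟨?_, fun ξ₁ η₁ ξ₂ η₂ h₁ h₂ t ht => ?_⟩
  · let H : ℝ → Matrix (Fin n ⊕ Fin n) (Fin n ⊕ Fin n) ℝ := fun t =>
      fromBlocks (A t + Abar t) (-G t) (-Q t) (-(A t)ᵀ)
    have hH : ContinuousOn H (Icc 0 T) := by
      have hAA := hAc.add hAbarc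
      have hAT := hAc.transpose.neg
      have hGn := hGc.neg
      have hQn := hQc.neg
      rw [continuousOn_iff_continuous_domRestrict] at *
      exact Continuous.matrix_fromBlocks hAA hGn hQn hAT
    obtain ⟨Ψ, hΨ0, hΨ⟩ := exists_fundamental_matrix hT.le hH
    have hinl : ∀ z, ∀ t ∈ Icc (0 : ℝ) T,
        HasDerivWithinAt (fun s => (Ψ s *ᵥ z) ∘ Sum.inl)
          ((A t + Abar t) *ᵥ ((Ψ t *ᵥ z) ∘ Sum.inl) - G t *ᵥ ((Ψ t *ᵥ z) ∘ Sum.inr))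
          (Icc 0 T) t := fun z t ht => by
      refine hasDerivWithinAt_pi.2 fun i => ?_
      refine (hasDerivWithinAt_pi.1 (hΨ z t ht) (Sum.inl i)).congr_deriv ?_
      simp [H, fromBlocks_mulVec, neg_mulVec, sub_eq_add_neg, -mulVec_mulVec]
    have hinr : ∀ z, ∀ t ∈ Icc (0 : ℝ) T,
        HasDerivWithinAt (fun s => (Ψ s *ᵥ z) ∘ Sum.inr)
          (-((Q t + Qbar t * (1 - S t)) *ᵥ ((Ψ t *ᵥ z) ∘ Sum.inl)
            + (A t)ᵀ *ᵥ ((Ψ t *ᵥ z) ∘ Sum.inr))) (Icc 0 T) t := fun z t ht => by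
      refine hasDerivWithinAt_pi.2 fun i => ?_
      refine (hasDerivWithinAt_pi.1 (hΨ z t ht) (Sum.inr i)).congr_deriv ?_
      simp [H, fromBlocks_mulVec, neg_mulVec, hSt t ht, add_comm, -mulVec_mulVec]
    let shoot : (Fin n ⊕ Fin n → ℝ) →ₗ[ℝ] (Fin n → ℝ) :=
      { toFun := fun z => (Ψ T *ᵥ z) ∘ Sum.inr - QT *ᵥ ((Ψ T *ᵥ z) ∘ Sum.inl)
        map_add' := fun z w => by
          rw [mulVec_add, Pi.add_comp, Pi.add_comp, mulVec_add]
          abel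
        map_smul' := fun c z => by
          rw [mulVec_smul, Pi.smul_comp, Pi.smul_comp, mulVec_smul, smul_sub, RingHom.id_apply] }
    have hsol : ∀ (x p : Fin n → ℝ), shoot (Sum.elim x p) = 0 →
        IsNewRicSol n m T A Abar S Q Qbar B R QT QbarT ST x
          (fun s => (Ψ s *ᵥ Sum.elim x p) ∘ Sum.inl) (fun s => (Ψ s *ᵥ Sum.elim x p) ∘ Sum.inr) :=
      fun x p hp => ⟨hinl _, by simp [hΨ0], hinr _, by rw [hST]; exact sub_eq_zero.1 hp⟩
    let emb : (Fin n → ℝ) →ₗ[ℝ] (Fin n ⊕ Fin n → ℝ) :=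
      { toFun := fun p => Sum.elim 0 p
        map_add' := fun p q => by rw [← Sum.elim_add_add, add_zero]
        map_smul' := fun c p => by funext i; cases i <;> simp }
    have hinj : Function.Injective (shoot ∘ₗ emb) := by
      refine (injective_iff_map_eq_zero _).2 fun p hp => ?_
      have h := (hzero _ _ (hsol 0 p hp) 0 (left_mem_Icc.2 hT.le)).2
      simpa [hΨ0] using h
    obtain ⟨p, hp⟩ := LinearMap.injective_iff_surjective.1 hinj (-shoot (Sum.elim x₀ 0))
    refine ⟨_, _, hsol x₀ p ?_⟩
    have hsplit : (Sum.elim x₀ p : Fin n ⊕ Fin n → ℝ) = Sum.elim x₀ 0 + emb p := by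
      funext i
      cases i <;> simp [emb]
    rw [hsplit, map_add]
    exact (congrArg _ hp).trans (add_neg_cancel _)
  · have hdiff : IsNewRicSol n m T A Abar S Q Qbar B R QT QbarT ST 0
        (fun s => ξ₁ s - ξ₂ s) (fun s => η₁ s - η₂ s) := by
      refine ⟨fun s hs => ?_, by simp [h₁.2.1, h₂.2.1], fun s hs => ?_, ?_⟩
      · refine ((h₁.1 s hs).sub (h₂.1 s hs)).congr_deriv ?_
        simp only [mulVec_sub]
        abel
      · refine ((h₁.2.2.1 s hs).sub (h₂.2.2.1 s hs)).congr_deriv ?_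
        simp only [mulVec_sub]
        abel
      · simp only [h₁.2.2.2, h₂.2.2.2, mulVec_sub]
    have h := hzero _ _ hdiff t ht
    exact ⟨sub_eq_zero.1 h.1, sub_eq_zero.1 h.2⟩

end
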